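/- Let A = (A^i)_{i<d_1} be a family of D_1×D_2 complex matrices and B = (B^j)_{j<d_2} a family of D_2×D_1 complex matrices such that the MPS tensors AB (with matrices A^i B^j, bond dimension D_1, physical dimension d_1·d_2) and BA (with matrices B^j A^i, bond dimension D_2) are both normal. Let C = (C^i)_{i<d_1} be D̃_1×D̃_2 matrices and D = (D^j)_{j<d_2} be D̃_2×D̃_1 matrices such that V_n(CD) = V_n(AB) for all n ≥ 1, i.e., Tr(C^{i_1}D^{j_1}⋯C^{i_n}D^{j_n}) = Tr(A^{i_1}B^{j_1}⋯A^{i_n}B^{j_n}) for all index strings. Then: (a) V_n(DC) = V_n(BA) for all n ≥ 1; and (b) if (V,W) is a reduction from CD to AB and (Ṽ,W̃) is a reduction from DC to BA, then there exist λ, μ ∈ ℂ and k₀ ∈ ℕ such that for all k ≥ k₀ and all index strings: A^{i_1}B^{j_1}A^{i_2}⋯B^{j_k}A^{i_{k+1}} = λ · V C^{i_1}D^{j_1}C^{i_2}⋯D^{j_k}C^{i_{k+1}} W̃ and B^{j_1}A^{i_1}B^{j_2}⋯A^{i_k}B^{j_{k+1}} = μ · Ṽ D^{j_1}C^{i_1}D^{j_2}⋯C^{i_k}D^{j_{k+1}}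 W. -/

import Mathlib

open Matrix
open scoped ComplexOrder

noncomputable section

/-- The ordered product of the matrices of an MPS tensor (physical index type `ι`). -/
def mpsProd {D : ℕ} {ι : Type*} (A : ι → Matrix (Fin D) (Fin D) ℂ) {n : ℕ}
    (i : Fin n → ι) : Matrix (Fin D) (Fin D) ℂ :=
  (List.ofFn fun k => A (i k)).prod

/-- The transfer map `T_A : ρ ↦ ∑ i, A i * ρ * (A i)ᴴ` of an MPS tensor. -/
def transferMap {D : ℕ} {ι : Type*} [Fintype ι] (A : ι → Matrix (Fin D) (Fin D) ℂ)
    (ρ : Matrix (Fin D) (Fin D) ℂ) : Matrix (Fin D) (Fin D) ℂ :=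
  ∑ i, A i * ρ * (A i)ᴴ

/-- `A` is normal: some iterate of the transfer map sends every nonzero
positive semidefinite matrix to a positive definite matrix. -/
def IsPrimitive {D : ℕ} {ι : Type*} [Fintype ι] (A : ι → Matrix (Fin D) (Fin D) ℂ) : Prop :=
  ∃ n : ℕ, 1 ≤ n ∧ ∀ ρ : Matrix (Fin D) (Fin D) ℂ, ρ.PosSemidef → ρ ≠ 0 →
    ((transferMap A)^[n] ρ).PosDef

/-- The alternating product `A^{i_1} B^{j_1} A^{i_2} ⋯ B^{j_k} A^{i_{k+1}}`
of two families of rectangular matrices. -/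
def altProd {D₁ D₂ d₁ d₂ : ℕ} (A : Fin d₁ → Matrix (Fin D₁) (Fin D₂) ℂ)
    (B : Fin d₂ → Matrix (Fin D₂) (Fin D₁) ℂ) :
    (k : ℕ) → (Fin (k + 1) → Fin d₁) → (Fin k → Fin d₂) → Matrix (Fin D₁) (Fin D₂) ℂ
  | 0, i, _ => A (i 0)
  | (k + 1), i, j =>
      A (i 0) * B (j 0) * altProd A B k (fun t => i t.succ) (fun t => j t.succ)

open Polynomial in
/-- Fitting idempotent: in a finite-dimensional algebra, some polynomial without constant term
turns `z` into an idempotent fixing a power of `z`. -/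
lemma exists_fitting_idempotent {R : Type*} [Ring R] [Algebra ℂ R] [Module.Finite ℂ R] (z : R) :
    ∃ (g : ℂ[X]) (r : ℕ), IsIdempotentElem (aeval z (g * X)) ∧
      aeval z (g * X) * z ^ (r + 1) = z ^ (r + 1) := by
  have hz : IsIntegral ℂ z := Algebra.IsIntegral.isIntegral z
  obtain ⟨q, hq, hnd⟩ := exists_eq_pow_rootMultiplicity_mul_and_not_dvd (minpoly ℂ z)
    (minpoly.ne_zero hz) 0
  rw [C_0, sub_zero] at hq hnd
  set r := (minpoly ℂ z).rootMultiplicity 0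
  have hco : IsCoprime (X ^ (r + 1) : ℂ[X]) q :=
    ((irreducible_X.coprime_iff_not_dvd).2 hnd).pow_left
  obtain ⟨u, v, huv⟩ := hco
  have h0 : aeval z (X ^ (r + 1) * q) = 0 := by
    rw [pow_succ', mul_assoc, ← hq, map_mul, minpoly.aeval, mul_zero]
  have key : ∀ t : ℂ[X], aeval z (t * (X ^ (r + 1) * q)) = 0 := fun t => by
    rw [map_mul, h0, mul_zero]
  refine ⟨u * X ^ r, r, ?_, ?_⟩
  · rw [IsIdempotentElem, ← map_mul, ← sub_eq_zero, ← map_sub]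
    convert key (-(u * v)) using 2
    linear_combination (u * X ^ (r + 1)) * huv
  · have hx : z ^ (r + 1) = aeval z (X ^ (r + 1) : ℂ[X]) := by simp
    rw [hx, ← map_mul, ← sub_eq_zero, ← map_sub]
    convert key (-v) using 2
    linear_combination (X ^ (r + 1)) * huv

/-- An idempotent matrix of trace one is of rank one. -/
lemma exists_eq_vecMulVec_of_trace_eq_one {m : Type*} [Fintype m] [DecidableEq m]
    {e : Matrix m m ℂ} (he : IsIdempotentElem e) (ht : e.trace = 1) :
    ∃ x y : m → ℂ, e = vecMulVec x y := by
  have hp : IsIdempotentElem (toLin' e) := by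
    rw [IsIdempotentElem, Module.End.mul_eq_comp, ← toLin'_mul, he.eq]
  have h1 := (LinearMap.IsIdempotentElem.isProj_range _ hp).trace
  rw [trace_toLin'_eq, ht] at h1
  have h2 : Module.finrank ℂ (LinearMap.range (toLin' e)) = 1 := by exact_mod_cast h1.symm
  obtain ⟨x, -, hx⟩ := finrank_eq_one_iff'.1 h2
  choose c hc using fun j => hx ⟨toLin' e (Pi.single j 1), LinearMap.mem_range_self _ _⟩
  refine ⟨x, c, ?_⟩
  ext i j
  have := congrFun (congrArg Subtype.val (hc j)) i
  simp at this
  rw [vecMulVec_apply, ← this, mul_comm]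

lemma exists_list_prod_eq_zero_of_isNilpotent {m : Type*} [Fintype m] [DecidableEq m]
    (J : Submodule ℂ (Matrix m m ℂ)) (hmul : ∀ a ∈ J, ∀ b ∈ J, a * b ∈ J)
    (hnil : ∀ a ∈ J, IsNilpotent a) :
    ∃ N : ℕ, ∀ l : List (Matrix m m ℂ), (∀ a ∈ l, a ∈ J) → N ≤ l.length → l.prod = 0 := by
  let : LieRing (Module.End ℂ (m → ℂ)) := LieRing.ofAssociativeRing
  let L : LieSubalgebra ℂ (Module.End ℂ (m → ℂ)) :=
    { J.comap (LinearMap.toMatrix' (R := ℂ) (m := m) (n := m)).toLinearMap with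
      lie_mem' := by
        intro x y hx hy
        change LinearMap.toMatrix' ⁅x, y⁆ ∈ J
        rw [Ring.lie_def, map_sub, LinearMap.toMatrix'_mul, LinearMap.toMatrix'_mul]
        exact J.sub_mem (hmul _ hx _ hy) (hmul _ hy _ hx) }
  have hL : LieModule.IsNilpotent L (m → ℂ) := by
    rw [LieModule.isNilpotent_iff_forall (R := ℂ)]
    intro x
    obtain ⟨k, hk⟩ := hnil _ x.2
    refine ⟨k, ?_⟩
    change (x : Module.End ℂ (m → ℂ)) ^ k = 0
    apply LinearMap.toMatrix'.injective
    rw [map_zero, ← hk]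
    exact map_pow (LinearMap.toMatrixAlgEquiv' (R := ℂ) (n := m)) _ _
  obtain ⟨N, hN⟩ := (LieModule.isNilpotent_iff ℂ L (m → ℂ)).1 hL
  have key : ∀ l : List (Matrix m m ℂ), (∀ a ∈ l, a ∈ J) → ∀ v : m → ℂ,
      l.prod *ᵥ v ∈ LieModule.lowerCentralSeries ℂ L (m → ℂ) l.length := by
    intro l
    induction l with
    | nil => intro _ v; simp
    | cons a l ih =>
      intro h v
      rw [List.prod_cons, ← mulVec_mulVec, List.length_cons, LieModule.lowerCentralSeries_succ]
      have ha : toLin' a ∈ L := by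
        change LinearMap.toMatrix' (toLin' a) ∈ J
        rw [LinearMap.toMatrix'_toLin']
        exact h a (by simp)
      have := LieSubmodule.lie_mem_lie (LieSubmodule.mem_top (R := ℂ) (L := L) (⟨_, ha⟩ : L))
        (ih (fun b hb => h b (by simp [hb])) v)
      exact this
  refine ⟨N, fun l hl hlen => ?_⟩
  apply toLin'.injective
  refine LinearMap.ext fun v => ?_
  have := key l hl v
  have h2 := LieModule.antitone_lowerCentralSeries ℂ L (m → ℂ) hlen this
  rw [hN] at h2
  rw [toLin'_apply, map_zero, LinearMap.zero_apply]
  exact (LieSubmodule.mem_bot _).1 h2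

/-- **Burnside's theorem** for a unital subalgebra of a matrix algebra. -/
lemma subalgebra_eq_top_of_irreducible {n : Type*} [Fintype n] [DecidableEq n] [Nonempty n]
    (R : Subalgebra ℂ (Matrix n n ℂ))
    (h : ∀ x : n → ℂ, x ≠ 0 → ∀ y, ∃ r ∈ R, r *ᵥ x = y) : R = ⊤ := by
  let R' : Subalgebra ℂ (Module.End ℂ (n → ℂ)) := R.map (toLinAlgEquiv' (R := ℂ) (n := n)).toAlgHom
  have : IsSimpleModule R' (n → ℂ) := by
    rw [isSimpleModule_iff_toSpanSingleton_surjective]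
    refine ⟨inferInstance, fun x hx y => ?_⟩
    obtain ⟨r, hr, hry⟩ := h x hx y
    exact ⟨⟨_, Subalgebra.mem_map.2 ⟨r, hr, rfl⟩⟩, hry⟩
  rw [eq_top_iff]
  intro a _
  have hschur := (IsSimpleModule.algebraMap_end_bijective_of_isAlgClosed (A := R') (V := n → ℂ) ℂ).2
  let f : Module.End (Module.End R' (n → ℂ)) (n → ℂ) :=
    { toFun := fun v => a *ᵥ v
      map_add' := mulVec_add a
      map_smul' := by
        intro g v
        obtain ⟨c, rfl⟩ := hschur g
        simp [mulVec_smul] }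
  obtain ⟨r, hr⟩ := jacobson_density (R := R') (M := n → ℂ) f
    (Finset.univ.image fun j : n => Pi.single j (1 : ℂ))
  obtain ⟨b, hb, hbr⟩ := Subalgebra.mem_map.1 r.2
  suffices a = b by rwa [this]
  apply toLin'.injective
  ext1 j
  have h1 := hr (Pi.single j 1) (by simp)
  have h2 : a *ᵥ Pi.single j 1 = (r : Module.End ℂ (n → ℂ)) (Pi.single j 1) := h1
  rw [← hbr] at h2
  ext i
  simpa using congrFun h2 i

section WordSpan

variable {ι m n : Type*} [Fintype m] [DecidableEq m] [Fintype n] [DecidableEq n]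

/-- The product of the matrices `X p` along a word `w`. -/
def wordProd (X : ι → Matrix m m ℂ) (w : List ι) : Matrix m m ℂ := (w.map X).prod

@[simp] lemma wordProd_nil (X : ι → Matrix m m ℂ) : wordProd X [] = 1 := rfl

@[simp] lemma wordProd_cons (X : ι → Matrix m m ℂ) (p : ι) (w : List ι) :
    wordProd X (p :: w) = X p * wordProd X w := rfl

lemma wordProd_append (X : ι → Matrix m m ℂ) (u v : List ι) :
    wordProd X (u ++ v) = wordProd X u * wordProd X v := by
  simp [wordProd]

/-- The span of the pairs of word products of two families, over nonempty words. -/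
def wordSpan (X : ι → Matrix m m ℂ) (S : ι → Matrix n n ℂ) :
    Submodule ℂ (Matrix m m ℂ × Matrix n n ℂ) :=
  Submodule.span ℂ {z | ∃ w : List ι, w ≠ [] ∧ z = (wordProd X w, wordProd S w)}

variable {X : ι → Matrix m m ℂ} {S : ι → Matrix n n ℂ}

lemma word_mem_wordSpan {w : List ι} (hw : w ≠ []) :
    (wordProd X w, wordProd S w) ∈ wordSpan X S :=
  Submodule.subset_span ⟨w, hw, rfl⟩

lemma letter_mem_wordSpan (p : ι) : (X p, S p) ∈ wordSpan X S := by
  simpa using word_mem_wordSpan (X := X) (S := S) (List.cons_ne_nil p [])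

lemma mul_mem_wordSpan {a b : Matrix m m ℂ × Matrix n n ℂ} (ha : a ∈ wordSpan X S)
    (hb : b ∈ wordSpan X S) : a * b ∈ wordSpan X S := by
  have h := Submodule.mul_mem_mul ha hb
  rw [wordSpan, Submodule.span_mul_span] at h
  refine Submodule.span_mono ?_ h
  rintro _ ⟨_, ⟨u, hu, rfl⟩, _, ⟨v, -, rfl⟩, rfl⟩
  exact ⟨u ++ v, by simp [hu], by simp [wordProd_append]⟩

lemma wordProd_mul_mem_wordSpan (u : List ι) {b : Matrix m m ℂ × Matrix n n ℂ}
    (hb : b ∈ wordSpan X S) : (wordProd X u, wordProd S u) * b ∈ wordSpan X S := by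
  rcases eq_or_ne u [] with rfl | hu
  · simpa [← Prod.one_eq_mk] using hb
  · exact mul_mem_wordSpan (word_mem_wordSpan hu) hb

lemma trace_eq_of_mem_wordSpan
    (htr : ∀ w : List ι, w ≠ [] → (wordProd X w).trace = (wordProd S w).trace)
    {z : Matrix m m ℂ × Matrix n n ℂ} (hz : z ∈ wordSpan X S) : z.1.trace = z.2.trace := by
  refine Submodule.span_induction ?_ ?_ ?_ ?_ hz
  · rintro _ ⟨w, hw, rfl⟩
    exact htr w hw
  · simp
  · intro x y _ _ hx hy
    simp [hx, hy]
  · intro c x _ hx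
    simp [hx]

open Polynomial in
lemma aeval_mul_X_mem_wordSpan {z : Matrix m m ℂ × Matrix n n ℂ} (hz : z ∈ wordSpan X S)
    (g : ℂ[X]) : aeval z (g * Polynomial.X) ∈ wordSpan X S := by
  induction g using Polynomial.induction_on' with
  | add p q hp hq => rw [add_mul, map_add]; exact add_mem hp hq
  | monomial k c =>
    rw [monomial_mul_X, aeval_monomial, ← Algebra.smul_def]
    refine Submodule.smul_mem _ c ?_
    induction k with
    | zero => simpa using hz
    | succ k ih => rw [pow_succ]; exact mul_mem_wordSpan ih hz

/-- Elements of the trace radical are nilpotent. -/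
lemma isNilpotent_of_mem_wordSpan
    (htr : ∀ w : List ι, w ≠ [] → (wordProd X w).trace = (wordProd S w).trace)
    {a : Matrix m m ℂ} (ha : (a, (0 : Matrix n n ℂ)) ∈ wordSpan X S) : IsNilpotent a := by
  obtain ⟨g, r, he, her⟩ := exists_fitting_idempotent (a, (0 : Matrix n n ℂ))
  have hmem := aeval_mul_X_mem_wordSpan ha g
  have htr' := trace_eq_of_mem_wordSpan htr hmem
  have h2 : (Polynomial.aeval (a, (0 : Matrix n n ℂ)) (g * Polynomial.X)).2 = 0 := by
    rw [map_mul, Polynomial.aeval_X]; simp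
  set e := Polynomial.aeval (a, (0 : Matrix n n ℂ)) (g * Polynomial.X)
  rw [h2, trace_zero] at htr'
  have hp : IsIdempotentElem (toLin' e.1) := by
    rw [IsIdempotentElem, Module.End.mul_eq_comp, ← toLin'_mul,
      show e.1 * e.1 = e.1 from congrArg Prod.fst he.eq]
  have h0 : toLin' e.1 = 0 :=
    LinearMap.IsIdempotentElem.eq_zero_of_trace_eq_zero hp (by rw [trace_toLin'_eq, htr'])
  have h1 : e.1 = 0 := by simpa using h0
  refine ⟨r + 1, ?_⟩
  have := congrArg Prod.fst her
  rw [Prod.fst_mul, h1, zero_mul] at this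
  exact this.symm

open Polynomial in
lemma aeval_mul_X_of_isIdempotentElem {R : Type*} [Ring R] [Algebra ℂ R] {s : R}
    (hs : IsIdempotentElem s) (g : ℂ[X]) : aeval s (g * Polynomial.X) = g.eval 1 • s := by
  induction g using Polynomial.induction_on' with
  | add p q hp hq => rw [add_mul, map_add, hp, hq, eval_add, add_smul]
  | monomial k c =>
    rw [monomial_mul_X, aeval_monomial, hs.pow_succ_eq, eval_monomial, one_pow, mul_one,
      ← Algebra.smul_def]

open Polynomial in
/-- Idempotents lift along the trace radical. -/
lemma exists_idempotent_lift {a : Matrix m m ℂ} {s : Matrix n n ℂ} (hs : IsIdempotentElem s)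
    (ha : (a, s) ∈ wordSpan X S) : ∃ e, IsIdempotentElem e ∧ (e, s) ∈ wordSpan X S := by
  obtain ⟨g, r, he, her⟩ := exists_fitting_idempotent (a, s)
  have hmem := aeval_mul_X_mem_wordSpan ha g
  have hc : (aeval (a, s) (g * Polynomial.X)).2 = g.eval 1 • s := by
    rw [← aeval_mul_X_of_isIdempotentElem hs]
    exact (aeval_algHom_apply (AlgHom.snd ℂ (Matrix m m ℂ) (Matrix n n ℂ)) (a, s) _).symm
  have h3 := congrArg Prod.snd her
  rw [Prod.snd_mul, hc] at h3
  simp only [Prod.pow_snd, hs.pow_succ_eq, smul_mul_assoc, hs.eq] at h3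
  refine ⟨_, congrArg Prod.fst he.eq, ?_⟩
  rwa [← Prod.mk.eta (p := aeval _ _), hc.trans h3] at hmem

/-- Irreducibility of a family of matrices: no proper subspace contains the image of a nonzero
vector under the family and is invariant. -/
def IsIrreducibleFamily (S : ι → Matrix n n ℂ) : Prop :=
  ∀ x : n → ℂ, x ≠ 0 → ∀ U : Submodule ℂ (n → ℂ),
    (∀ i, S i *ᵥ x ∈ U) → (∀ i, ∀ u ∈ U, S i *ᵥ u ∈ U) → U = ⊤

/-- **Burnside's theorem** for the span of nonempty words. -/
lemma exists_mem_wordSpan_of_irreducible [Nonempty n] (hS : IsIrreducibleFamily S)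
    (s : Matrix n n ℂ) : ∃ a, (a, s) ∈ wordSpan X S := by
  let Q : Submodule ℂ (Matrix n n ℂ) := (wordSpan X S).map (LinearMap.snd ℂ _ _)
  have hQ : ∀ {s}, s ∈ Q ↔ ∃ a, (a, s) ∈ wordSpan X S := by
    intro s
    simp [Q]
  have hQmul : ∀ a ∈ Q, ∀ b ∈ Q, a * b ∈ Q := by
    intro a ha b hb
    obtain ⟨a', ha'⟩ := hQ.1 ha
    obtain ⟨b', hb'⟩ := hQ.1 hb
    exact hQ.2 ⟨_, mul_mem_wordSpan ha' hb'⟩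
  have hact : ∀ x : n → ℂ, x ≠ 0 → ∀ y, ∃ r ∈ Q, r *ᵥ x = y := by
    intro x hx y
    have hU : Q.map ((LinearMap.flip (mulVecBilin ℂ ℂ)) x) = ⊤ := by
      refine hS x hx _ (fun i => ?_) ?_
      · exact ⟨S i, hQ.2 ⟨_, letter_mem_wordSpan i⟩, rfl⟩
      · rintro i _ ⟨q, hq, rfl⟩
        exact ⟨S i * q, hQmul _ (hQ.2 ⟨_, letter_mem_wordSpan i⟩) _ hq, by simp [mulVecBilin]⟩
    obtain ⟨q, hq, rfl⟩ := hU.ge (Submodule.mem_top (x := y))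
    exact ⟨q, hq, rfl⟩
  let R₁ : Subalgebra ℂ (Matrix n n ℂ) :=
    { carrier := {r | ∀ q ∈ Q, r * q ∈ Q}
      mul_mem' := fun {a b} ha hb q hq => by rw [mul_assoc]; exact ha _ (hb q hq)
      add_mem' := fun {a b} ha hb q hq => by rw [add_mul]; exact Q.add_mem (ha q hq) (hb q hq)
      algebraMap_mem' := fun c q hq => by rw [← Algebra.smul_def]; exact Q.smul_mem c hq }
  let R₂ : Subalgebra ℂ (Matrix n n ℂ) :=
    { carrier := {r | ∀ q ∈ Q, q * r ∈ Q}
      mul_mem' := fun {a b} ha hb q hq => by rw [← mul_assoc]; exact hb _ (ha q hq)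
      add_mem' := fun {a b} ha hb q hq => by rw [mul_add]; exact Q.add_mem (ha q hq) (hb q hq)
      algebraMap_mem' := fun c q hq => by
        rw [← Algebra.commutes, ← Algebra.smul_def]; exact Q.smul_mem c hq }
  have h₁ : R₁ = ⊤ := subalgebra_eq_top_of_irreducible R₁ fun x hx y => by
    obtain ⟨r, hr, h⟩ := hact x hx y
    exact ⟨r, fun q hq => hQmul r hr q hq, h⟩
  have h₂ : R₂ = ⊤ := subalgebra_eq_top_of_irreducible R₂ fun x hx y => by
    obtain ⟨r, hr, h⟩ := hact x hx y
    exact ⟨r, fun q hq => hQmul q hq r hr, h⟩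
  have hleft : ∀ a, ∀ q ∈ Q, a * q ∈ Q := fun a => h₁.ge (Algebra.mem_top (x := a))
  have hright : ∀ a, ∀ q ∈ Q, q * a ∈ Q := fun a => h₂.ge (Algebra.mem_top (x := a))
  obtain ⟨i₀⟩ := ‹Nonempty n›
  obtain ⟨q, hq, hqi⟩ := hact (Pi.single i₀ 1) (by simp) (Pi.single i₀ 1)
  have hq1 : q i₀ i₀ = 1 := by simpa using congrFun hqi i₀
  refine hQ.1 ?_
  rw [matrix_eq_sum_single s]
  refine Submodule.sum_mem _ fun i _ => Submodule.sum_mem _ fun j _ => ?_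
  have := hright (single i₀ j (s i j)) _ (hleft (single i i₀ 1) q hq)
  rwa [single_mul_mul_single, hq1, one_mul, one_mul] at this

/-- The unique nontrivial composition factor of `X`, embedded as a corner: matrices `φ`, `ψ` with
`φ * ψ` in the algebra of words, lifting `1`, and compressing `X` to `S`. -/
lemma exists_corner [Nonempty n] (hS : IsIrreducibleFamily S)
    (htr : ∀ w : List ι, w ≠ [] → (wordProd X w).trace = (wordProd S w).trace) :
    ∃ (φ : Matrix m n ℂ) (ψ : Matrix n m ℂ), (φ * ψ, (1 : Matrix n n ℂ)) ∈ wordSpan X S ∧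
      ∀ z ∈ wordSpan X S, ψ * z.1 * φ = z.2 := by
  obtain ⟨i₀⟩ := ‹Nonempty n›
  have : Nonempty n := ⟨i₀⟩
  have hidem : IsIdempotentElem (single i₀ i₀ (1 : ℂ)) := by
    rw [IsIdempotentElem, single_mul_single_same, one_mul]
  obtain ⟨a₀, ha₀⟩ := exists_mem_wordSpan_of_irreducible (X := X) hS (single i₀ i₀ 1)
  obtain ⟨e, he, hemem⟩ := exists_idempotent_lift hidem ha₀
  have het : e.trace = 1 := by
    rw [trace_eq_of_mem_wordSpan htr hemem]; simp
  obtain ⟨x, y, hxy⟩ := exists_eq_vecMulVec_of_trace_eq_one he het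
  choose a ha using fun k => exists_mem_wordSpan_of_irreducible (X := X) hS (single k i₀ 1)
  choose b hb using fun k => exists_mem_wordSpan_of_irreducible (X := X) hS (single i₀ k 1)
  refine ⟨of fun i k => (a k *ᵥ x) i, of fun k => y ᵥ* b k, ?_, ?_⟩
  · have hsum : (∑ k, ((a k, single k i₀ 1) * (e, single i₀ i₀ 1) * (b k, single i₀ k 1) :
        Matrix m m ℂ × Matrix n n ℂ)) ∈ wordSpan X S :=
      Submodule.sum_mem _ fun k _ => mul_mem_wordSpan (mul_mem_wordSpan (ha k) hemem) (hb k)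
    convert hsum using 1
    refine Prod.ext ?_ ?_
    · rw [Prod.fst_sum]
      ext i j
      rw [Matrix.sum_apply]
      change ((of fun i k => (a k *ᵥ x) i) * of fun k => y ᵥ* b k : Matrix m m ℂ) i j = _
      rw [Matrix.mul_apply]
      refine Finset.sum_congr rfl fun k _ => ?_
      simp only [Prod.fst_mul, hxy, mul_vecMulVec, vecMulVec_mul, vecMulVec_apply, of_apply]
    · rw [Prod.snd_sum]
      simp [← sum_single_one]
  · rintro ⟨c, s⟩ hc
    ext l k
    have h := trace_eq_of_mem_wordSpan htr (mul_mem_wordSpan (mul_mem_wordSpan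
      (mul_mem_wordSpan hemem (hb l)) hc) (ha k))
    simp only [Prod.fst_mul, Prod.snd_mul, single_mul_single_same, single_mul_mul_single,
      trace_single_eq_same, one_mul, mul_one, hxy, vecMulVec_mul, trace_vecMulVec] at h
    refine Eq.trans ?_ h
    change (y ᵥ* b l ᵥ* c) ⬝ᵥ (a k *ᵥ x) = _
    rw [dotProduct_mulVec, dotProduct_comm]

/-- Between two long words, a word of `X` only acts through the composition factor `S`. -/
theorem exists_long_word_factorization [Nonempty n] (hS : IsIrreducibleFamily S)
    (htr : ∀ w : List ι, w ≠ [] → (wordProd X w).trace = (wordProd S w).trace) :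
    ∃ (φ : Matrix m n ℂ) (ψ : Matrix n m ℂ) (N : ℕ), ∀ u w v : List ι,
      N ≤ u.length → w ≠ [] → N ≤ v.length →
        wordProd X u * wordProd X w * wordProd X v =
          wordProd X u * φ * wordProd S w * (ψ * wordProd X v) := by
  obtain ⟨φ, ψ, he, hcorner⟩ := exists_corner hS htr
  let J : Submodule ℂ (Matrix m m ℂ) := (wordSpan X S).comap (LinearMap.inl ℂ _ _)
  have hJ : ∀ {a}, a ∈ J ↔ (a, (0 : Matrix n n ℂ)) ∈ wordSpan X S := Iff.rfl
  obtain ⟨N, hN⟩ := exists_list_prod_eq_zero_of_isNilpotent J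
    (fun a ha b hb => by simpa [hJ] using mul_mem_wordSpan (hJ.1 ha) (hJ.1 hb))
    (fun a ha => isNilpotent_of_mem_wordSpan htr (hJ.1 ha))
  have hcor : ∀ z ∈ wordSpan X S, φ * ψ * z.1 * (φ * ψ) = φ * z.2 * ψ := fun z hz => by
    rw [← hcorner z hz]; simp only [Matrix.mul_assoc]
  set e := φ * ψ with he_def
  set f := 1 - e with hf_def
  have hxf : ∀ p, X p * f ∈ J := fun p => by
    have h := sub_mem (letter_mem_wordSpan (X := X) (S := S) p)
      (mul_mem_wordSpan (letter_mem_wordSpan p) he)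
    simpa [hJ, hf_def, mul_sub] using h
  have hlong : ∀ u : List ι, N ≤ u.length → (u.map fun p => X p * f).prod = 0 := fun u hu =>
    hN _ (by simpa using fun p _ => hxf p) (by simpa using hu)
  have hsplit : ∀ (u : List ι) (z), z ∈ wordSpan X S →
      (wordProd X u * f * z.1, (0 : Matrix n n ℂ)) ∈ wordSpan X S := fun u z hz => by
    convert sub_mem (wordProd_mul_mem_wordSpan u hz)
      (wordProd_mul_mem_wordSpan u (mul_mem_wordSpan he hz)) using 1
    ext1 <;> simp [hf_def, mul_sub, sub_mul, mul_assoc]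
  have hefe : ∀ (u : List ι) (z), z ∈ wordSpan X S →
      e * (wordProd X u * f * z.1) * e = 0 := fun u z hz => by
    simpa using hcor _ (hsplit u z hz)
  have hleft : ∀ (u : List ι) (z), z ∈ wordSpan X S →
      wordProd X u * f * z.1 * e = (u.map fun p => X p * f).prod * (f * z.1 * e) := by
    intro u z hz
    induction u with
    | nil => simp [mul_assoc]
    | cons p u ih =>
      have h : X p * (e * (wordProd X u * f * z.1) * e) = 0 := by rw [hefe u z hz, mul_zero]
      rw [List.map_cons, List.prod_cons, mul_assoc (X p * f), ← ih, hf_def, wordProd_cons,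
        ← sub_eq_zero, ← h]
      simp only [hf_def]
      noncomm_ring
  have hleft0 : ∀ (u : List ι) (z), N ≤ u.length → z ∈ wordSpan X S →
      wordProd X u * f * z.1 * e = 0 := fun u z hu hz => by
    rw [hleft u z hz, hlong u hu, zero_mul]
  have hright : ∀ (v : List ι) (T : Matrix m m ℂ), (∀ z ∈ wordSpan X S, T * f * z.1 * e = 0) →
      T * f * wordProd X v = T * f * (v.map fun p => X p * f).prod := by
    intro v
    induction v with
    | nil => intro T _; simp
    | cons p v ih =>
      intro T hT
      have h := hT _ (letter_mem_wordSpan p)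
      have hT' := ih (T * f * X p) fun z hz => by
        simpa [mul_assoc] using hT _ (hsplit [p] z hz)
      have h2 : T * f * X p = T * f * X p * f := by
        rw [← sub_eq_zero, ← h]
        simp only [hf_def]
        noncomm_ring
      rw [List.map_cons, List.prod_cons, wordProd_cons, ← mul_assoc, h2, hT']
      simp only [mul_assoc]
  have hright0 : ∀ (v : List ι) (T : Matrix m m ℂ), N ≤ v.length →
      (∀ z ∈ wordSpan X S, T * f * z.1 * e = 0) → T * f * wordProd X v = 0 :=
    fun v T hv hT => by rw [hright v T hT, hlong v hv, mul_zero]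
  refine ⟨φ, ψ, N, fun u w v hu hw hv => ?_⟩
  have hwm := word_mem_wordSpan (X := X) (S := S) hw
  have h1 : wordProd X u * f * (wordProd X w * wordProd X v) = 0 := by
    rw [← wordProd_append]
    exact hright0 _ _ (by simp; omega) fun z => hleft0 u z hu
  have h2 : wordProd X u * wordProd X w * f * wordProd X v = 0 := by
    rw [← wordProd_append]
    exact hright0 _ _ hv fun z => hleft0 _ z (by simp; omega)
  have h3 : wordProd X u * f * wordProd X w * f * wordProd X v = 0 := by
    refine hright0 _ _ hv fun z hz => ?_
    simpa [mul_assoc] using hleft0 u _ hu (hsplit w z hz)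
  have h4 : wordProd X u * e * wordProd X w * e * wordProd X v =
      wordProd X u * φ * wordProd S w * (ψ * wordProd X v) := by
    have := hcor _ hwm
    calc _ = wordProd X u * (e * wordProd X w * e) * wordProd X v := by
          simp only [mul_assoc]
      _ = wordProd X u * (φ * wordProd S w * ψ) * wordProd X v := by rw [this]
      _ = _ := by simp only [Matrix.mul_assoc]
  rw [← h4]
  have h5 : e = 1 - f := by rw [hf_def]; abel
  rw [h5, ← sub_eq_zero]
  calc _ = wordProd X u * f * (wordProd X w * wordProd X v) +
        wordProd X u * wordProd X w * f * wordProd X v -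
        wordProd X u * f * wordProd X w * f * wordProd X v := by noncomm_ring
    _ = 0 := by rw [h1, h2, h3]; simp

/-- A vanishing criterion for tails of words. -/
lemma eq_zero_of_mul_long_words_eq_zero [Nonempty n] (hS : IsIrreducibleFamily S) {l : Type*}
    (P : Matrix l n ℂ) (N : ℕ) (h : ∀ u : List ι, N ≤ u.length → P * wordProd S u = 0) :
    P = 0 := by
  induction N with
  | zero => simpa using h [] (by simp)
  | succ N ih =>
    refine ih fun u hu => ?_
    have key : ∀ z ∈ wordSpan S S, P * wordProd S u * z.2 = 0 := by
      intro z hz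
      refine Submodule.span_induction ?_ ?_ ?_ ?_ hz
      · rintro _ ⟨w, hw, rfl⟩
        rw [Matrix.mul_assoc, ← wordProd_append]
        have := List.length_pos_iff.2 hw
        exact h _ (by simp; omega)
      · simp
      · intro x y _ _ hx hy
        simp [Matrix.mul_add, hx, hy]
      · intro c x _ hx
        simp [hx]
    obtain ⟨a, ha⟩ := exists_mem_wordSpan_of_irreducible (X := S) hS 1
    simpa using key _ ha

lemma eq_zero_of_long_words_mul_eq_zero [Nonempty n] (hS : IsIrreducibleFamily S) {l : Type*}
    (P : Matrix n l ℂ) (N : ℕ) (h : ∀ u : List ι, N ≤ u.length → wordProd S u * P = 0) :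
    P = 0 := by
  induction N with
  | zero => simpa using h [] (by simp)
  | succ N ih =>
    refine ih fun u hu => ?_
    have key : ∀ z ∈ wordSpan S S, z.2 * (wordProd S u * P) = 0 := by
      intro z hz
      refine Submodule.span_induction ?_ ?_ ?_ ?_ hz
      · rintro _ ⟨w, hw, rfl⟩
        rw [← Matrix.mul_assoc, ← wordProd_append]
        have := List.length_pos_iff.2 hw
        exact h _ (by simp; omega)
      · simp
      · intro x y _ _ hx hy
        simp [Matrix.add_mul, hx, hy]
      · intro c x _ hx
        simp [hx]
    obtain ⟨a, ha⟩ := exists_mem_wordSpan_of_irreducible (X := S) hS 1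
    simpa using key _ ha

end WordSpan

/-- Two factorizations of the same nonzero sandwich maps differ by a scalar. -/
lemma exists_scalar_of_sandwich_eq {n p q U V : Type*} [Fintype n] [DecidableEq n]
    (G P : U → Matrix p n ℂ) (H Q : V → Matrix n q ℂ)
    (h : ∀ u v (Z : Matrix n n ℂ), G u * Z * H v = P u * Z * Q v)
    (hP : ∃ u, P u ≠ 0) (hQ : ∃ v, Q v ≠ 0) :
    ∃ c : ℂ, c ≠ 0 ∧ (∀ u, G u = c • P u) ∧ ∀ v, Q v = c • H v := by
  have key : ∀ u v i k l j, G u i k * H v l j = P u i k * Q v l j := by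
    intro u v i k l j
    simpa [Matrix.mul_apply, single_apply, Finset.sum_ite, ite_and] using
      congrFun (congrFun (h u v (single k l 1)) i) j
  obtain ⟨u₀, hu⟩ := hP
  obtain ⟨v₀, hv⟩ := hQ
  obtain ⟨i₀, k₀, hp⟩ : ∃ i k, P u₀ i k ≠ 0 := by
    by_contra! h0
    exact hu (Matrix.ext h0)
  obtain ⟨l₀, j₀, hq⟩ : ∃ l j, Q v₀ l j ≠ 0 := by
    by_contra! h0
    exact hv (Matrix.ext h0)
  have h0 := key u₀ v₀ i₀ k₀ l₀ j₀
  have hH : H v₀ l₀ j₀ ≠ 0 := fun hz => mul_ne_zero hp hq (by rw [← h0, hz, mul_zero])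
  have hG : G u₀ i₀ k₀ ≠ 0 := fun hz => mul_ne_zero hp hq (by rw [← h0, hz, zero_mul])
  refine ⟨Q v₀ l₀ j₀ / H v₀ l₀ j₀, div_ne_zero hq hH, fun u => ?_, fun v => ?_⟩
  · ext i k
    have := key u v₀ i k l₀ j₀
    rw [Matrix.smul_apply, smul_eq_mul]
    field_simp
    linear_combination this
  · ext l j
    have := key u₀ v i₀ k₀ l j
    rw [Matrix.smul_apply, smul_eq_mul]
    field_simp
    refine mul_left_cancel₀ hp ?_
    linear_combination (-H v₀ l₀ j₀) * this + (H v l j) * h0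

section Compression

universe u

variable {ι m n : Type*} {p₁ p₂ : Type u} [Fintype m] [DecidableEq m] [Fintype n] [DecidableEq n]
  {X : ι → Matrix m m ℂ} {S : ι → Matrix n n ℂ}

/-- A compression of long `X`-words to `S`-words determines the compressing factors
up to a scalar. -/
lemma exists_scalar_of_compression [Nonempty n] (hS : IsIrreducibleFamily S)
    {φ : Matrix m n ℂ} {ψ : Matrix n m ℂ} {N : ℕ}
    (hfac : ∀ u w v : List ι, N ≤ u.length → w ≠ [] → N ≤ v.length →
      wordProd X u * wordProd X w * wordProd X v =
        wordProd X u * φ * wordProd S w * (ψ * wordProd X v))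
    {V : Matrix p₁ m ℂ} {W : Matrix m p₁ ℂ} {P : Matrix p₁ n ℂ} {Q : Matrix n p₁ ℂ}
    (hP : P ≠ 0) (hQ : Q ≠ 0) (hred : ∀ w, V * wordProd X w * W = P * wordProd S w * Q) :
    ∃ c : ℂ, c ≠ 0 ∧
      (∀ u : List ι, N ≤ u.length → V * wordProd X u * φ = c • (P * wordProd S u)) ∧
      ∀ v : List ι, N ≤ v.length → wordProd S v * Q = c • (ψ * wordProd X v * W) := by
  have h : ∀ (u v : {u : List ι // N ≤ u.length}) (Z : Matrix n n ℂ),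
      V * wordProd X u.1 * φ * Z * (ψ * wordProd X v.1 * W) =
        P * wordProd S u.1 * Z * (wordProd S v.1 * Q) := by
    rintro ⟨u, hu⟩ ⟨v, hv⟩ Z
    have key : ∀ z ∈ wordSpan S S, V * wordProd X u * φ * z.2 * (ψ * wordProd X v * W) =
        P * wordProd S u * z.2 * (wordProd S v * Q) := by
      intro z hz
      refine Submodule.span_induction ?_ ?_ ?_ ?_ hz
      · rintro _ ⟨w, hw, rfl⟩
        calc _ = V * (wordProd X u * φ * wordProd S w * (ψ * wordProd X v)) * W := by
              simp only [Matrix.mul_assoc]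
          _ = V * wordProd X (u ++ w ++ v) * W := by
              rw [← hfac u w v hu hw hv, wordProd_append, wordProd_append]
          _ = _ := by
              rw [hred, wordProd_append, wordProd_append]
              simp only [Matrix.mul_assoc]
      · simp
      · intro x y _ _ hx hy
        simp only [Prod.snd_add, Matrix.mul_add, Matrix.add_mul, hx, hy]
      · intro c x _ hx
        simp only [Prod.smul_snd, Matrix.mul_smul, Matrix.smul_mul, hx]
    obtain ⟨a, ha⟩ := exists_mem_wordSpan_of_irreducible (X := S) hS Z
    exact key (a, Z) ha
  have hP' : ∃ u : {u : List ι // N ≤ u.length}, P * wordProd S u.1 ≠ 0 := by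
    by_contra! h0
    exact hP (eq_zero_of_mul_long_words_eq_zero hS P N fun u hu => h0 ⟨u, hu⟩)
  have hQ' : ∃ v : {v : List ι // N ≤ v.length}, wordProd S v.1 * Q ≠ 0 := by
    by_contra! h0
    exact hQ (eq_zero_of_long_words_mul_eq_zero hS Q N fun v hv => h0 ⟨v, hv⟩)
  obtain ⟨c, hc, hG, hH⟩ := exists_scalar_of_sandwich_eq
    (fun u : {u : List ι // N ≤ u.length} => V * wordProd X u.1 * φ)
    (fun u => P * wordProd S u.1)
    (fun v : {v : List ι // N ≤ v.length} => ψ * wordProd X v.1 * W)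
    (fun v => wordProd S v.1 * Q) h hP' hQ'
  exact ⟨c, hc, fun u hu => hG ⟨u, hu⟩, fun v hv => hH ⟨v, hv⟩⟩

/-- Two compressions of trace-equivalent families agree on their mixed parts, up to scalars. -/
theorem exists_scalar_of_mixed_compression [Nonempty n] (hS : IsIrreducibleFamily S)
    (htr : ∀ w : List ι, w ≠ [] → (wordProd X w).trace = (wordProd S w).trace)
    {V₁ : Matrix p₁ m ℂ} {W₁ : Matrix m p₁ ℂ} {P₁ : Matrix p₁ n ℂ} {Q₁ : Matrix n p₁ ℂ}
    {V₂ : Matrix p₂ m ℂ} {W₂ : Matrix m p₂ ℂ} {P₂ : Matrix p₂ n ℂ} {Q₂ : Matrix n p₂ ℂ}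
    (hP₁ : P₁ ≠ 0) (hQ₁ : Q₁ ≠ 0) (hP₂ : P₂ ≠ 0) (hQ₂ : Q₂ ≠ 0)
    (hred₁ : ∀ w, V₁ * wordProd X w * W₁ = P₁ * wordProd S w * Q₁)
    (hred₂ : ∀ w, V₂ * wordProd X w * W₂ = P₂ * wordProd S w * Q₂) :
    ∃ (a b : ℂ) (N : ℕ), ∀ w : List ι, N ≤ w.length →
      P₁ * wordProd S w * Q₂ = a • (V₁ * wordProd X w * W₂) ∧
      P₂ * wordProd S w * Q₁ = b • (V₂ * wordProd X w * W₁) := by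
  obtain ⟨φ, ψ, N, hfac⟩ := exists_long_word_factorization hS htr
  obtain ⟨c₁, hc₁, hG₁, hH₁⟩ := exists_scalar_of_compression hS hfac hP₁ hQ₁ hred₁
  obtain ⟨c₂, hc₂, hG₂, hH₂⟩ := exists_scalar_of_compression hS hfac hP₂ hQ₂ hred₂
  refine ⟨c₁⁻¹ * c₂, c₂⁻¹ * c₁, 2 * N + 1, fun y hy => ?_⟩
  obtain ⟨u, w, v, rfl, hu, hw, hv⟩ : ∃ u w v : List ι, y = u ++ w ++ v ∧ N ≤ u.length ∧
      w ≠ [] ∧ N ≤ v.length := by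
    refine ⟨y.take N, (y.drop N).take 1, (y.drop N).drop 1, ?_, ?_, ?_, ?_⟩
    · rw [List.append_assoc, List.take_append_drop, List.take_append_drop]
    · simp; omega
    · rw [← List.length_pos_iff]; simp; omega
    · simp; omega
  have hX : ∀ {p q : Type u} (V : Matrix p m ℂ) (W : Matrix m q ℂ),
      V * wordProd X (u ++ w ++ v) * W =
        V * wordProd X u * φ * wordProd S w * (ψ * wordProd X v * W) := by
    intro p q V W
    rw [wordProd_append, wordProd_append, hfac u w v hu hw hv]
    simp only [Matrix.mul_assoc]
  have hSw : ∀ {p q : Type u} (P : Matrix p n ℂ) (Q : Matrix n q ℂ),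
      P * wordProd S (u ++ w ++ v) * Q = P * wordProd S u * wordProd S w * (wordProd S v * Q) := by
    intro p q P Q
    rw [wordProd_append, wordProd_append]
    simp only [Matrix.mul_assoc]
  constructor
  · rw [hX, hSw, hG₁ u hu, hH₂ v hv]
    simp [smul_smul, mul_comm, hc₁]
  · rw [hX, hSw, hG₂ u hu, hH₁ v hv]
    simp [smul_smul, mul_comm, hc₂]

end Compression

/-- A normal tensor has no proper invariant subspace, even one that only contains the images of
some nonzero vector. -/
lemma IsPrimitive.submodule_eq_top {D : ℕ} {ι : Type*} [Fintype ι]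
    {A : ι → Matrix (Fin D) (Fin D) ℂ} (hA : IsPrimitive A) {x : Fin D → ℂ} (hx : x ≠ 0)
    {U : Submodule ℂ (Fin D → ℂ)} (hxU : ∀ i, A i *ᵥ x ∈ U)
    (hU : ∀ i, ∀ u ∈ U, A i *ᵥ u ∈ U) : U = ⊤ := by
  obtain ⟨n, hn, hpos⟩ := hA
  have key : ∀ (n : ℕ) (v : Fin D → ℂ),
      (transferMap A)^[n + 1] (vecMulVec x (star x)) *ᵥ v ∈ U := by
    intro n
    induction n with
    | zero =>
      intro v
      simp only [zero_add, Function.iterate_one, transferMap, sum_mulVec]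
      refine Submodule.sum_mem _ fun i _ => ?_
      rw [← mulVec_mulVec, ← mulVec_mulVec, vecMulVec_mulVec, op_smul_eq_smul, mulVec_smul]
      exact U.smul_mem _ (hxU i)
    | succ n ih =>
      intro v
      rw [Function.iterate_succ_apply', transferMap, sum_mulVec]
      refine Submodule.sum_mem _ fun i _ => ?_
      rw [← mulVec_mulVec, ← mulVec_mulVec]
      exact hU i _ (ih _)
  have hne : vecMulVec x (star x) ≠ 0 := by
    simpa [vecMulVec_eq_zero] using hx
  have hu := (hpos _ (posSemidef_vecMulVec_self_star x) hne).isUnit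
  obtain ⟨k, rfl⟩ : ∃ k, n = k + 1 := ⟨n - 1, by omega⟩
  refine eq_top_iff.2 fun y _ => ?_
  obtain ⟨v, rfl⟩ := mulVec_surjective_iff_isUnit.2 hu y
  exact key k v

section Graded

variable {D₁ D₂ E₁ E₂ d₁ d₂ : ℕ}

/-- Two families of rectangular matrices as a single family of off-diagonal block matrices. -/
def gradedFamily (C : Fin d₁ → Matrix (Fin E₁) (Fin E₂) ℂ)
    (F : Fin d₂ → Matrix (Fin E₂) (Fin E₁) ℂ) :
    Fin d₁ ⊕ Fin d₂ → Matrix (Fin E₁ ⊕ Fin E₂) (Fin E₁ ⊕ Fin E₂) ℂ :=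
  Sum.elim (fun i => fromBlocks 0 (C i) 0 0) fun j => fromBlocks 0 0 (F j) 0

@[simp] lemma gradedFamily_inl (C : Fin d₁ → Matrix (Fin E₁) (Fin E₂) ℂ)
    (F : Fin d₂ → Matrix (Fin E₂) (Fin E₁) ℂ) (i : Fin d₁) :
    gradedFamily C F (Sum.inl i) = fromBlocks 0 (C i) 0 0 := rfl

@[simp] lemma gradedFamily_inr (C : Fin d₁ → Matrix (Fin E₁) (Fin E₂) ℂ)
    (F : Fin d₂ → Matrix (Fin E₂) (Fin E₁) ℂ) (j : Fin d₂) :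
    gradedFamily C F (Sum.inr j) = fromBlocks 0 0 (F j) 0 := rfl

lemma gradedFamily_irreducible (A : Fin d₁ → Matrix (Fin D₁) (Fin D₂) ℂ)
    (B : Fin d₂ → Matrix (Fin D₂) (Fin D₁) ℂ)
    (hAB : IsPrimitive (fun p : Fin d₁ × Fin d₂ => A p.1 * B p.2))
    (hBA : IsPrimitive (fun p : Fin d₂ × Fin d₁ => B p.1 * A p.2)) :
    IsIrreducibleFamily (gradedFamily A B) := by
  intro x hx U hxU hU
  have hinl : ∀ i (u : Fin D₁ ⊕ Fin D₂ → ℂ),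
      gradedFamily A B (Sum.inl i) *ᵥ u = Sum.elim (A i *ᵥ (u ∘ Sum.inr)) 0 := by
    intro i u
    simp [fromBlocks_mulVec]
  have hinr : ∀ j (u : Fin D₁ ⊕ Fin D₂ → ℂ),
      gradedFamily A B (Sum.inr j) *ᵥ u = Sum.elim (0 : Fin D₁ → ℂ) (B j *ᵥ (u ∘ Sum.inl)) := by
    intro j u
    simp [fromBlocks_mulVec]
  let L₁ : (Fin D₁ → ℂ) →ₗ[ℂ] (Fin D₁ ⊕ Fin D₂ → ℂ) :=
    { toFun := fun y => Sum.elim y 0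
      map_add' := fun y z => by ext (i | i) <;> simp
      map_smul' := fun c y => by ext (i | i) <;> simp }
  let L₂ : (Fin D₂ → ℂ) →ₗ[ℂ] (Fin D₁ ⊕ Fin D₂ → ℂ) :=
    { toFun := fun y => Sum.elim 0 y
      map_add' := fun y z => by ext (i | i) <;> simp
      map_smul' := fun c y => by ext (i | i) <;> simp }
  set U₁ := U.comap L₁
  set U₂ := U.comap L₂
  have hA : ∀ i, ∀ y ∈ U₂, A i *ᵥ y ∈ U₁ := by
    intro i y hy
    have := hU (Sum.inl i) _ hy
    rw [hinl] at this
    exact this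
  have hB : ∀ j, ∀ y ∈ U₁, B j *ᵥ y ∈ U₂ := by
    intro j y hy
    have := hU (Sum.inr j) _ hy
    rw [hinr] at this
    exact this
  have hxA : ∀ i, A i *ᵥ (x ∘ Sum.inr) ∈ U₁ := fun i => by
    have := hxU (Sum.inl i)
    rwa [hinl] at this
  have hxB : ∀ j, B j *ᵥ (x ∘ Sum.inl) ∈ U₂ := fun j => by
    have := hxU (Sum.inr j)
    rwa [hinr] at this
  have hAB' : ∀ y ≠ 0, (∀ j, B j *ᵥ y ∈ U₂) → U₁ = ⊤ := fun y hy h =>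
    hAB.submodule_eq_top hy (fun p => by rw [← mulVec_mulVec]; exact hA _ _ (h _))
      fun p u hu => by rw [← mulVec_mulVec]; exact hA _ _ (hB _ _ hu)
  have hBA' : ∀ y ≠ 0, (∀ i, A i *ᵥ y ∈ U₁) → U₂ = ⊤ := fun y hy h =>
    hBA.submodule_eq_top hy (fun p => by rw [← mulVec_mulVec]; exact hB _ _ (h _))
      fun p u hu => by rw [← mulVec_mulVec]; exact hB _ _ (hA _ _ hu)
  have h12 : U₁ = ⊤ → U₂ = ⊤ := by
    intro h
    by_contra hne
    obtain ⟨y, -, hy⟩ := SetLike.exists_of_lt (lt_top_iff_ne_top.2 hne)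
    exact hne (hBA' y (by rintro rfl; exact hy U₂.zero_mem) fun i => by rw [h]; trivial)
  have h21 : U₂ = ⊤ → U₁ = ⊤ := by
    intro h
    by_contra hne
    obtain ⟨y, -, hy⟩ := SetLike.exists_of_lt (lt_top_iff_ne_top.2 hne)
    exact hne (hAB' y (by rintro rfl; exact hy U₁.zero_mem) fun i => by rw [h]; trivial)
  obtain ⟨h1, h2⟩ : U₁ = ⊤ ∧ U₂ = ⊤ := by
    by_cases hx₁ : x ∘ Sum.inl = 0
    · have hx₂ : x ∘ Sum.inr ≠ 0 := by
        intro hx₂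
        refine hx (funext ?_)
        rintro (i | i)
        · exact congrFun hx₁ i
        · exact congrFun hx₂ i
      have := hBA' _ hx₂ hxA
      exact ⟨h21 this, this⟩
    · have := hAB' _ hx₁ hxB
      exact ⟨this, h12 this⟩
  refine eq_top_iff.2 fun y _ => ?_
  have hy₁ : y ∘ Sum.inl ∈ U₁ := by rw [h1]; trivial
  have hy₂ : y ∘ Sum.inr ∈ U₂ := by rw [h2]; trivial
  have : y = Sum.elim (y ∘ Sum.inl) 0 + Sum.elim (0 : Fin D₁ → ℂ) (y ∘ Sum.inr) := by
    ext (i | i) <;> simp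
  rw [this]
  exact U.add_mem hy₁ hy₂

lemma toBlocks₁₁_wordProd (A : Fin d₁ → Matrix (Fin D₁) (Fin D₂) ℂ)
    (B : Fin d₂ → Matrix (Fin D₂) (Fin D₁) ℂ) (C : Fin d₁ → Matrix (Fin E₁) (Fin E₂) ℂ)
    (F : Fin d₂ → Matrix (Fin E₂) (Fin E₁) ℂ) (w : List (Fin d₁ ⊕ Fin d₂)) :
    ((wordProd (gradedFamily A B) w).toBlocks₁₁ = 0 ∧
      (wordProd (gradedFamily C F) w).toBlocks₁₁ = 0) ∨
    ∃ l : List (Fin d₁ × Fin d₂), (w ≠ [] → l ≠ []) ∧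
      (wordProd (gradedFamily A B) w).toBlocks₁₁ = wordProd (fun p => A p.1 * B p.2) l ∧
      (wordProd (gradedFamily C F) w).toBlocks₁₁ = wordProd (fun p => C p.1 * F p.2) l := by
  have hone : ∀ {a b : ℕ}, (1 : Matrix (Fin a ⊕ Fin b) (Fin a ⊕ Fin b) ℂ).toBlocks₁₁ = 1 := by
    intro a b
    rw [← fromBlocks_one, toBlocks_fromBlocks₁₁]
  have hstep : ∀ {a b : ℕ} (X : Matrix (Fin a) (Fin b) ℂ) (Y : Matrix (Fin b) (Fin a) ℂ)
      (M : Matrix (Fin a ⊕ Fin b) (Fin a ⊕ Fin b) ℂ),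
      (fromBlocks 0 X 0 0 * (fromBlocks 0 0 Y 0 * M)).toBlocks₁₁ = X * Y * M.toBlocks₁₁ := by
    intro a b X Y M
    rw [← fromBlocks_toBlocks M]
    simp [fromBlocks_multiply, Matrix.mul_assoc]
  have hinl : ∀ {a b : ℕ} (X Y : Matrix (Fin a) (Fin b) ℂ)
      (M : Matrix (Fin a ⊕ Fin b) (Fin a ⊕ Fin b) ℂ),
      (fromBlocks 0 X 0 0 * (fromBlocks 0 Y 0 0 * M)).toBlocks₁₁ = 0 := by
    intro a b X Y M
    rw [← fromBlocks_toBlocks M]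
    simp [fromBlocks_multiply]
    rfl
  have hinr : ∀ {a b : ℕ} (Y : Matrix (Fin b) (Fin a) ℂ)
      (M : Matrix (Fin a ⊕ Fin b) (Fin a ⊕ Fin b) ℂ),
      (fromBlocks 0 0 Y 0 * M).toBlocks₁₁ = 0 := by
    intro a b Y M
    rw [← fromBlocks_toBlocks M]
    simp [fromBlocks_multiply]
  match w with
  | [] => exact Or.inr ⟨[], by simp, by simp [hone], by simp [hone]⟩
  | [Sum.inl a] => exact Or.inl (by simp)
  | Sum.inl a :: Sum.inl b :: w => exact Or.inl (by simp [hinl])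
  | Sum.inr b :: w => exact Or.inl (by simp [hinr])
  | Sum.inl a :: Sum.inr b :: w =>
    rcases toBlocks₁₁_wordProd A B C F w with ⟨h1, h2⟩ | ⟨l, -, h1, h2⟩
    · exact Or.inl (by simp [hstep, h1, h2])
    · exact Or.inr ⟨(a, b) :: l, by simp, by simp [hstep, h1],
        by simp [hstep, h2]⟩

lemma toBlocks₂₂_wordProd_eq_swap (C : Fin d₁ → Matrix (Fin E₁) (Fin E₂) ℂ)
    (F : Fin d₂ → Matrix (Fin E₂) (Fin E₁) ℂ) (w : List (Fin d₁ ⊕ Fin d₂)) :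
    (wordProd (gradedFamily C F) w).toBlocks₂₂ =
      (wordProd (gradedFamily F C) (w.map Sum.swap)).toBlocks₁₁ := by
  have key : wordProd (gradedFamily F C) (w.map Sum.swap) =
      (wordProd (gradedFamily C F) w).submatrix (Equiv.sumComm _ _) (Equiv.sumComm _ _) := by
    induction w with
    | nil => exact (submatrix_one_equiv (Equiv.sumComm (Fin E₂) (Fin E₁))).symm
    | cons p w ih =>
      rw [List.map_cons, wordProd_cons, wordProd_cons, ← submatrix_mul_equiv _ _ _
        (Equiv.sumComm _ _), ih]
      congr 1
      rcases p with i | j <;> ext (a | a) (b | b) <;> simp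
  rw [key]
  rfl

lemma toBlocks₂₂_wordProd (A : Fin d₁ → Matrix (Fin D₁) (Fin D₂) ℂ)
    (B : Fin d₂ → Matrix (Fin D₂) (Fin D₁) ℂ) (C : Fin d₁ → Matrix (Fin E₁) (Fin E₂) ℂ)
    (F : Fin d₂ → Matrix (Fin E₂) (Fin E₁) ℂ) (w : List (Fin d₁ ⊕ Fin d₂)) :
    ((wordProd (gradedFamily A B) w).toBlocks₂₂ = 0 ∧
      (wordProd (gradedFamily C F) w).toBlocks₂₂ = 0) ∨
    ∃ l : List (Fin d₂ × Fin d₁), (w ≠ [] → l ≠ []) ∧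
      (wordProd (gradedFamily A B) w).toBlocks₂₂ = wordProd (fun p => B p.1 * A p.2) l ∧
      (wordProd (gradedFamily C F) w).toBlocks₂₂ = wordProd (fun p => F p.1 * C p.2) l := by
  simpa only [toBlocks₂₂_wordProd_eq_swap, ne_eq, List.map_eq_nil_iff] using
    toBlocks₁₁_wordProd B A F C (w.map Sum.swap)

lemma exists_mul_wordProd_mul (l : List (Fin d₂ × Fin d₁)) (a : Fin d₁) (b : Fin d₂) :
    ∃ l' : List (Fin d₁ × Fin d₂), l' ≠ [] ∧
      ∀ {E₁ E₂ : ℕ} (C : Fin d₁ → Matrix (Fin E₁) (Fin E₂) ℂ)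
        (F : Fin d₂ → Matrix (Fin E₂) (Fin E₁) ℂ),
        C a * wordProd (fun p => F p.1 * C p.2) l * F b =
          wordProd (fun p => C p.1 * F p.2) l' := by
  induction l generalizing a with
  | nil => exact ⟨[(a, b)], by simp, fun C F => by simp⟩
  | cons p l ih =>
    obtain ⟨l', -, h⟩ := ih p.2
    refine ⟨(a, p.1) :: l', by simp, fun C F => ?_⟩
    rw [wordProd_cons, wordProd_cons, ← h]
    simp only [Matrix.mul_assoc]

/-- Shifting by one site preserves equality of the generated states. -/
lemma trace_wordProd_shift (A : Fin d₁ → Matrix (Fin D₁) (Fin D₂) ℂ)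
    (B : Fin d₂ → Matrix (Fin D₂) (Fin D₁) ℂ) (C : Fin d₁ → Matrix (Fin E₁) (Fin E₂) ℂ)
    (F : Fin d₂ → Matrix (Fin E₂) (Fin E₁) ℂ)
    (h : ∀ l : List (Fin d₁ × Fin d₂), l ≠ [] → (wordProd (fun p => C p.1 * F p.2) l).trace =
      (wordProd (fun p => A p.1 * B p.2) l).trace)
    (l : List (Fin d₂ × Fin d₁)) (hl : l ≠ []) :
    (wordProd (fun p => F p.1 * C p.2) l).trace = (wordProd (fun p => B p.1 * A p.2) l).trace := by
  obtain ⟨p, l, rfl⟩ := List.exists_cons_of_ne_nil hl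
  obtain ⟨l', hl', hrot⟩ := exists_mul_wordProd_mul l p.2 p.1
  rw [wordProd_cons, wordProd_cons, Matrix.mul_assoc, Matrix.trace_mul_comm, hrot, h l' hl',
    ← hrot, Matrix.trace_mul_comm, Matrix.mul_assoc]

/-- The word with alternating letters `f (i 0), g (j 0), f (i 1), …, f (i k)`. -/
def altWord {α β γ : Type*} (f : α → γ) (g : β → γ) :
    (k : ℕ) → (Fin (k + 1) → α) → (Fin k → β) → List γ
  | 0, i, _ => [f (i 0)]
  | (k + 1), i, j =>
      f (i 0) :: g (j 0) :: altWord f g k (fun t => i t.succ) (fun t => j t.succ)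

lemma length_altWord {α β γ : Type*} (f : α → γ) (g : β → γ) (k : ℕ) (i : Fin (k + 1) → α)
    (j : Fin k → β) : (altWord f g k i j).length = 2 * k + 1 := by
  induction k with
  | zero => rfl
  | succ k ih =>
    simp only [altWord, List.length_cons, ih]
    ring

lemma wordProd_altWord_inl (C : Fin d₁ → Matrix (Fin E₁) (Fin E₂) ℂ)
    (F : Fin d₂ → Matrix (Fin E₂) (Fin E₁) ℂ) (k : ℕ) (i : Fin (k + 1) → Fin d₁)
    (j : Fin k → Fin d₂) :
    wordProd (gradedFamily C F) (altWord Sum.inl Sum.inr k i j) =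
      fromBlocks 0 (altProd C F k i j) 0 0 := by
  induction k with
  | zero => simp [altWord, altProd, gradedFamily]
  | succ k ih =>
    rw [altWord, wordProd_cons, wordProd_cons, ih]
    simp [altProd, fromBlocks_multiply, Matrix.mul_assoc]

lemma wordProd_altWord_inr (C : Fin d₁ → Matrix (Fin E₁) (Fin E₂) ℂ)
    (F : Fin d₂ → Matrix (Fin E₂) (Fin E₁) ℂ) (k : ℕ) (j : Fin (k + 1) → Fin d₂)
    (i : Fin k → Fin d₁) :
    wordProd (gradedFamily C F) (altWord Sum.inr Sum.inl k j i) =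
      fromBlocks 0 0 (altProd F C k j i) 0 := by
  induction k with
  | zero => simp [altWord, altProd, gradedFamily]
  | succ k ih =>
    rw [altWord, wordProd_cons, wordProd_cons, ih]
    simp [altProd, fromBlocks_multiply, Matrix.mul_assoc]

end Graded

lemma mpsProd_eq_wordProd {D : ℕ} {ι : Type*} (A : ι → Matrix (Fin D) (Fin D) ℂ) {n : ℕ}
    (i : Fin n → ι) : mpsProd A i = wordProd A (List.ofFn i) := by
  rw [mpsProd, wordProd, List.map_ofFn]
  rfl

lemma forall_mpsProd_iff {ι : Type*} (p : List ι → Prop) :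
    (∀ n : ℕ, 1 ≤ n → ∀ i : Fin n → ι, p (List.ofFn i)) ↔ ∀ l : List ι, l ≠ [] → p l := by
  refine ⟨fun h l hl => ?_, fun h n hn i => h _ ?_⟩
  · simpa using h l.length (List.length_pos_iff.2 hl) l.get
  · rw [← List.length_pos_iff, List.length_ofFn]
    exact hn

lemma trace_wordProd_gradedFamily {D₁ D₂ E₁ E₂ d₁ d₂ : ℕ}
    (A : Fin d₁ → Matrix (Fin D₁) (Fin D₂) ℂ)
    (B : Fin d₂ → Matrix (Fin D₂) (Fin D₁) ℂ) (C : Fin d₁ → Matrix (Fin E₁) (Fin E₂) ℂ)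
    (F : Fin d₂ → Matrix (Fin E₂) (Fin E₁) ℂ)
    (h : ∀ l : List (Fin d₁ × Fin d₂), l ≠ [] → (wordProd (fun p => C p.1 * F p.2) l).trace =
      (wordProd (fun p => A p.1 * B p.2) l).trace)
    (w : List (Fin d₁ ⊕ Fin d₂)) (hw : w ≠ []) :
    (wordProd (gradedFamily C F) w).trace = (wordProd (gradedFamily A B) w).trace := by
  have hsum : ∀ {a b : ℕ} (M : Matrix (Fin a ⊕ Fin b) (Fin a ⊕ Fin b) ℂ),
      M.trace = M.toBlocks₁₁.trace + M.toBlocks₂₂.trace := by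
    intro a b M
    exact Fintype.sum_sum_type _
  rw [hsum, hsum (wordProd (gradedFamily A B) w)]
  congr 1
  · rcases toBlocks₁₁_wordProd A B C F w with ⟨h1, h2⟩ | ⟨l, hl, h1, h2⟩
    · rw [h1, h2, trace_zero, trace_zero]
    · rw [h1, h2, h l (hl hw)]
  · rcases toBlocks₂₂_wordProd A B C F w with ⟨h1, h2⟩ | ⟨l, hl, h1, h2⟩
    · rw [h1, h2, trace_zero, trace_zero]
    · rw [h1, h2, trace_wordProd_shift A B C F h l (hl hw)]

/-- **Reductions of two-site translationally invariant MPS, shifted by one site.**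
If `AB` and `BA` are normal and `CD` generates the same states as `AB`, then `DC`
generates the same states as `BA`; moreover, given reductions `(V,W)` from `CD` to `AB`
and `(Ṽ,W̃)` from `DC` to `BA`, long enough alternating products satisfy
`A…A = λ V C…C W̃` and `B…B = μ Ṽ D…D W`. -/
theorem alternating_reduction {D₁ D₂ E₁ E₂ d₁ d₂ : ℕ}
    (A : Fin d₁ → Matrix (Fin D₁) (Fin D₂) ℂ) (B : Fin d₂ → Matrix (Fin D₂) (Fin D₁) ℂ)
    (C : Fin d₁ → Matrix (Fin E₁) (Fin E₂) ℂ) (F : Fin d₂ → Matrix (Fin E₂) (Fin E₁) ℂ)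
    (hAB : IsPrimitive (fun p : Fin d₁ × Fin d₂ => A p.1 * B p.2))
    (hBA : IsPrimitive (fun p : Fin d₂ × Fin d₁ => B p.1 * A p.2))
    (hCD : ∀ n : ℕ, 1 ≤ n → ∀ i : Fin n → Fin d₁ × Fin d₂,
      (mpsProd (fun p : Fin d₁ × Fin d₂ => C p.1 * F p.2) i).trace =
        (mpsProd (fun p : Fin d₁ × Fin d₂ => A p.1 * B p.2) i).trace)
    (V : Matrix (Fin D₁) (Fin E₁) ℂ) (W : Matrix (Fin E₁) (Fin D₁) ℂ)
    (hVW : V * W = 1)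
    (hred : ∀ n : ℕ, 1 ≤ n → ∀ i : Fin n → Fin d₁ × Fin d₂,
      V * mpsProd (fun p : Fin d₁ × Fin d₂ => C p.1 * F p.2) i * W =
        mpsProd (fun p : Fin d₁ × Fin d₂ => A p.1 * B p.2) i)
    (V' : Matrix (Fin D₂) (Fin E₂) ℂ) (W' : Matrix (Fin E₂) (Fin D₂) ℂ)
    (hVW' : V' * W' = 1)
    (hred' : ∀ n : ℕ, 1 ≤ n → ∀ i : Fin n → Fin d₂ × Fin d₁,
      V' * mpsProd (fun p : Fin d₂ × Fin d₁ => F p.1 * C p.2) i * W' =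
        mpsProd (fun p : Fin d₂ × Fin d₁ => B p.1 * A p.2) i) :
    (∀ n : ℕ, 1 ≤ n → ∀ i : Fin n → Fin d₂ × Fin d₁,
      (mpsProd (fun p : Fin d₂ × Fin d₁ => F p.1 * C p.2) i).trace =
        (mpsProd (fun p : Fin d₂ × Fin d₁ => B p.1 * A p.2) i).trace) ∧
    ∃ (lam mu : ℂ) (k₀ : ℕ), ∀ k : ℕ, k₀ ≤ k →
      (∀ (i : Fin (k + 1) → Fin d₁) (j : Fin k → Fin d₂),
        altProd A B k i j = lam • (V * altProd C F k i j * W')) ∧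
      (∀ (j : Fin (k + 1) → Fin d₂) (i : Fin k → Fin d₁),
        altProd B A k j i = mu • (V' * altProd F C k j i * W)) := by
  have htr := (forall_mpsProd_iff fun l : List (Fin d₁ × Fin d₂) =>
      (wordProd (fun p => C p.1 * F p.2) l).trace =
    (wordProd (fun p => A p.1 * B p.2) l).trace).1 <| by
      simpa only [mpsProd_eq_wordProd] using hCD
  have hred₁ := (forall_mpsProd_iff fun l : List (Fin d₁ × Fin d₂) =>
      V * wordProd (fun p => C p.1 * F p.2) l * W =
    wordProd (fun p => A p.1 * B p.2) l).1 <| by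
      simpa only [mpsProd_eq_wordProd] using hred
  have hred₂ := (forall_mpsProd_iff fun l : List (Fin d₂ × Fin d₁) =>
      V' * wordProd (fun p => F p.1 * C p.2) l * W' =
    wordProd (fun p => B p.1 * A p.2) l).1 <| by
      simpa only [mpsProd_eq_wordProd] using hred'
  refine ⟨?_, ?_⟩
  · simp only [mpsProd_eq_wordProd]
    exact (forall_mpsProd_iff fun l : List (Fin d₂ × Fin d₁) =>
      (wordProd (fun p => F p.1 * C p.2) l).trace =
      (wordProd (fun p => B p.1 * A p.2) l).trace).2 (trace_wordProd_shift A B C F htr)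
  rcases Nat.eq_zero_or_pos D₁ with rfl | hD₁
  · exact ⟨0, 0, 0, fun k _ => ⟨fun i j => Subsingleton.elim _ _, fun j i => Subsingleton.elim _ _⟩⟩
  rcases Nat.eq_zero_or_pos D₂ with rfl | hD₂
  · exact ⟨0, 0, 0, fun k _ => ⟨fun i j => Subsingleton.elim _ _, fun j i => Subsingleton.elim _ _⟩⟩
  have : NeZero D₁ := ⟨hD₁.ne'⟩
  have : NeZero D₂ := ⟨hD₂.ne'⟩
  have hV : ∀ w, V * (wordProd (gradedFamily C F) w).toBlocks₁₁ * W =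
      (wordProd (gradedFamily A B) w).toBlocks₁₁ := by
    intro w
    rcases toBlocks₁₁_wordProd A B C F w with ⟨h1, h2⟩ | ⟨l, -, h1, h2⟩
    · rw [h1, h2, Matrix.mul_zero, Matrix.zero_mul]
    · rw [h1, h2]
      rcases eq_or_ne l [] with rfl | hl
      · simpa using hVW
      · exact hred₁ l hl
  have hV' : ∀ w, V' * (wordProd (gradedFamily C F) w).toBlocks₂₂ * W' =
      (wordProd (gradedFamily A B) w).toBlocks₂₂ := by
    intro w
    rcases toBlocks₂₂_wordProd A B C F w with ⟨h1, h2⟩ | ⟨l, -, h1, h2⟩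
    · rw [h1, h2, Matrix.mul_zero, Matrix.zero_mul]
    · rw [h1, h2]
      rcases eq_or_ne l [] with rfl | hl
      · simpa using hVW'
      · exact hred₂ l hl
  obtain ⟨a, b, N, hab⟩ := exists_scalar_of_mixed_compression
    (gradedFamily_irreducible A B hAB hBA) (trace_wordProd_gradedFamily A B C F htr)
    (V₁ := fromCols V 0) (W₁ := fromRows W 0) (P₁ := fromCols 1 0) (Q₁ := fromRows 1 0)
    (V₂ := fromCols 0 V') (W₂ := fromRows 0 W') (P₂ := fromCols 0 1) (Q₂ := fromRows 0 1)
    (fun h => by simpa using congrFun (congrFun h 0) (Sum.inl 0))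
    (fun h => by simpa using congrFun (congrFun h (Sum.inl 0)) 0)
    (fun h => by simpa using congrFun (congrFun h 0) (Sum.inr 0))
    (fun h => by simpa using congrFun (congrFun h (Sum.inr 0)) 0)
    (fun w => by
      rw [← fromBlocks_toBlocks (wordProd (gradedFamily C F) w),
        ← fromBlocks_toBlocks (wordProd (gradedFamily A B) w)]
      simpa [fromCols_mul_fromBlocks, fromCols_mul_fromRows] using hV w)
    (fun w => by
      rw [← fromBlocks_toBlocks (wordProd (gradedFamily C F) w),
        ← fromBlocks_toBlocks (wordProd (gradedFamily A B) w)]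
      simpa [fromCols_mul_fromBlocks, fromCols_mul_fromRows] using hV' w)
  refine ⟨a, b, N, fun k hk => ⟨fun i j => ?_, fun j i => ?_⟩⟩
  · have h := (hab (altWord Sum.inl Sum.inr k i j) (by rw [length_altWord]; omega)).1
    simpa [wordProd_altWord_inl, fromCols_mul_fromBlocks, fromCols_mul_fromRows] using h
  · have h := (hab (altWord Sum.inr Sum.inl k j i) (by rw [length_altWord]; omega)).2
    simpa [wordProd_altWord_inr, fromCols_mul_fromBlocks, fromCols_mul_fromRows] using h
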